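/- arXiv:2601.12608 — 2 statements merged into one kernel-verified Lean document; each statement's English description precedes it below -/
import Mathlib

section
/- Let n ≥ 1, let Ω ⊆ ℂⁿ be a bounded complete Reinhardt domain, X a nonzero complex Banach space, λ > 1 and 1 ≤ p < ∞. Then, for U the identity operator on X, B_λ(Ω,p,X) ≥ (λ^p − 1)^{1/p}/λ · n^{−1/p} / (S(Ω,𝔻ⁿ)·S(𝔻ⁿ,Ω)). -/
open scoped ENNReal Pointwise
open Filter

noncomputable section

namespace BohrPaper

/-- The monomial `z^α = z₁^{α₁} ⋯ z_n^{α_n}`. -/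
def mpow {n : ℕ} (z : Fin n → ℂ) (α : Fin n → ℕ) : ℂ := ∏ j, z j ^ α j

/-- A complete Reinhardt domain in `ℂⁿ`: nonempty, open, connected and closed under
componentwise decrease of moduli. -/
def IsCompleteReinhardt {n : ℕ} (Ω : Set (Fin n → ℂ)) : Prop :=
  IsOpen Ω ∧ IsConnected Ω ∧
    ∀ z ∈ Ω, ∀ w : Fin n → ℂ, (∀ j, ‖w j‖ ≤ ‖z j‖) → w ∈ Ω

/-- `S(Ω₁, Ω₂) := inf {s > 0 : Ω₁ ⊆ s·Ω₂}`. -/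
def SRatio {n : ℕ} (Ω₁ Ω₂ : Set (Fin n → ℂ)) : ℝ :=
  sInf {s : ℝ | 0 < s ∧ Ω₁ ⊆ s • Ω₂}

/-- The open unit polydisc `𝔻ⁿ`. -/
def polydisc (n : ℕ) : Set (Fin n → ℂ) := {z | ∀ j, ‖z j‖ < 1}

/-- The sup-norm of `f` over `Ω`. -/
def supNorm {n : ℕ} {E : Type*} [Norm E] (Ω : Set (Fin n → ℂ)) (f : (Fin n → ℂ) → E) : ℝ :=
  ⨆ z ∈ Ω, ‖f z‖

/-- The `ℓ_q`-norm on `ℂⁿ` (`q = ∞` gives the max norm). -/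
def lqNorm (n : ℕ) (q : ℝ≥0∞) (z : Fin n → ℂ) : ℝ :=
  if q = ∞ then ⨆ j, ‖z j‖
  else (∑ j, ‖z j‖ ^ q.toReal) ^ (1 / q.toReal)

/-- The open unit ball of `ℓⁿ_q`. -/
def lqBall (n : ℕ) (q : ℝ≥0∞) : Set (Fin n → ℂ) := {z | lqNorm n q z < 1}

/-- `N` is a norm on `ℂⁿ`. -/
def IsNorm {n : ℕ} (N : (Fin n → ℂ) → ℝ) : Prop :=
  (∀ z, 0 ≤ N z) ∧ (∀ z, N z = 0 → z = 0) ∧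
    (∀ (c : ℂ) (z), N (c • z) = ‖c‖ * N z) ∧ ∀ z w, N (z + w) ≤ N z + N w

/-- The canonical basis of `ℂⁿ` is normalized and 1-unconditional for the norm `N`. -/
def IsNormalized1Unconditional {n : ℕ} (N : (Fin n → ℂ) → ℝ) : Prop :=
  (∀ k, N (fun j => if j = k then 1 else 0) = 1) ∧
    ∀ ε μ : Fin n → ℂ, (∀ j, ‖ε j‖ ≤ 1) → N (fun j => ε j * μ j) ≤ N μ

/-- Open unit ball of the norm `N`. -/
def unitBall {n : ℕ} (N : (Fin n → ℂ) → ℝ) : Set (Fin n → ℂ) := {z | N z < 1}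

/-- Operator norm of the identity map `(ℂⁿ, N₁) → (ℂⁿ, N₂)`. -/
def idNorm {n : ℕ} (N₁ N₂ : (Fin n → ℂ) → ℝ) : ℝ :=
  sInf {c : ℝ | 0 ≤ c ∧ ∀ z, N₂ z ≤ c * N₁ z}

/-- `b_m(Ω) = (inf_{|α| = m} sup_{z ∈ Ω} |z^α|)^{-1/m}`. -/
def bCoef {n : ℕ} (Ω : Set (Fin n → ℂ)) (m : ℕ) : ℝ :=
  (sInf ((fun α : Fin n → ℕ => ⨆ z ∈ Ω, ‖mpow z α‖) ''
      {α : Fin n → ℕ | ∑ j, α j = m})) ^ (-(1 / (m : ℝ)))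

section Holomorphic

variable {n : ℕ} {X : Type*} [NormedAddCommGroup X] [NormedSpace ℂ X]
  {Y : Type*} [NormedAddCommGroup Y] [NormedSpace ℂ Y]

/-- `f` is a bounded holomorphic `X`-valued function on `Ω` with monomial expansion
`f = Σ a_α z^α` converging locally uniformly on `Ω`. -/
def IsBddHolomorphic (Ω : Set (Fin n → ℂ)) (f : (Fin n → ℂ) → X)
    (a : (Fin n → ℕ) → X) : Prop :=
  TendstoLocallyUniformlyOn
    (fun (s : Finset (Fin n → ℕ)) z => ∑ α ∈ s, mpow z α • a α) f atTop Ω ∧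
  BddAbove ((fun z => ‖f z‖) '' Ω)

/-- The left-hand side `Σ_α sup_{z ∈ rΩ} ‖U a_α‖^p |z^α|^p` of the second Bohr inequality
for holomorphic functions, valued in `ℝ≥0∞`. -/
def holBohrSum (Ω : Set (Fin n → ℂ)) (r p : ℝ) (U : X →L[ℂ] Y)
    (a : (Fin n → ℕ) → X) : ℝ≥0∞ :=
  ∑' α : Fin n → ℕ, ⨆ z ∈ r • Ω,
    ENNReal.ofReal (‖U (a α)‖ ^ p * ‖mpow z α‖ ^ p)

/-- The second `λ`-powered Bohr radius `B_λ(Ω, p, U)` for holomorphic functions. -/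
def secondBohrHol (Ω : Set (Fin n → ℂ)) (p lam : ℝ) (U : X →L[ℂ] Y) : ℝ :=
  sSup {r : ℝ | r ∈ Set.Icc (0 : ℝ) 1 ∧
    ∀ (f : (Fin n → ℂ) → X) (a : (Fin n → ℕ) → X), IsBddHolomorphic Ω f a →
      holBohrSum Ω r p U a ≤ ENNReal.ofReal (lam ^ p * supNorm Ω f ^ p)}

/-- The first `λ`-powered Bohr radius `K_λ(Ω, p, U)` for holomorphic functions. -/
def firstBohrHol (Ω : Set (Fin n → ℂ)) (p lam : ℝ) (U : X →L[ℂ] Y) : ℝ :=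
  sSup {r : ℝ | r ∈ Set.Icc (0 : ℝ) 1 ∧
    ∀ (f : (Fin n → ℂ) → X) (a : (Fin n → ℕ) → X), IsBddHolomorphic Ω f a →
      (⨆ z ∈ r • Ω, ∑' α : Fin n → ℕ,
        ENNReal.ofReal (‖U (a α)‖ ^ p * ‖mpow z α‖ ^ p)) ≤
        ENNReal.ofReal (lam ^ p * supNorm Ω f ^ p)}

end Holomorphic

theorem norm_mpow_of_norm_eq {n : ℕ} {z : Fin n → ℂ} {t : ℝ} (hz : ∀ j, ‖z j‖ = t)
    (α : Fin n → ℕ) : ‖mpow z α‖ = t ^ ∑ j, α j := by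
  simp [mpow, norm_prod, hz, Finset.prod_pow_eq_pow_sum]

theorem norm_mpow_le {n : ℕ} {z : Fin n → ℂ} {t : ℝ} (hz : ∀ j, ‖z j‖ ≤ t)
    (α : Fin n → ℕ) : ‖mpow z α‖ ≤ t ^ ∑ j, α j := by
  rw [mpow, norm_prod, ← Finset.prod_pow_eq_pow_sum]
  refine Finset.prod_le_prod (fun _ _ => norm_nonneg _) fun j _ => ?_
  rw [norm_pow]
  exact pow_le_pow_left₀ (norm_nonneg _) (hz j) _

theorem mpow_mul {n : ℕ} (z w : Fin n → ℂ) (α : Fin n → ℕ) :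
    mpow (fun j => z j * w j) α = mpow z α * mpow w α := by
  simp [mpow, mul_pow, Finset.prod_mul_distrib]

/-- Orthogonality of the characters of `ℤ/N` on exponents below `N`. -/
theorem sum_primitiveRoot_pow_mul_inv_pow {N : ℕ} {ζ : ℂ} (hζ : IsPrimitiveRoot ζ N)
    {a b : ℕ} (ha : a < N) (hb : b < N) :
    ∑ k ∈ Finset.range N, (ζ ^ k) ^ b * ((ζ ^ k)⁻¹) ^ a = if b = a then (N : ℂ) else 0 := by
  have hζ0 : ζ ≠ 0 := hζ.ne_zero (by omega)
  have key : ∀ k, (ζ ^ k) ^ b * ((ζ ^ k)⁻¹) ^ a = (ζ ^ b * (ζ ^ a)⁻¹) ^ k := by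
    intro k
    rw [mul_pow, inv_pow, inv_pow, ← pow_mul, ← pow_mul, ← pow_mul, ← pow_mul,
      mul_comm k b, mul_comm k a]
  simp_rw [key]
  split_ifs with h
  · subst h
    simp [mul_inv_cancel₀ (pow_ne_zero b hζ0)]
  · have hw : ζ ^ b * (ζ ^ a)⁻¹ ≠ 1 := by
      intro h1
      rw [← div_eq_mul_inv, div_eq_one_iff_eq (pow_ne_zero a hζ0)] at h1
      exact h (hζ.pow_inj hb ha h1)
    rw [geom_sum_eq hw, mul_pow, inv_pow, ← pow_mul, ← pow_mul, mul_comm b, mul_comm a,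
      pow_mul, pow_mul, hζ.pow_eq_one]
    simp

/-- Multivariate orthogonality: averaging monomials over the grid of `N`-th roots of unity. -/
theorem sum_mpow_mul_mpow_inv {n N : ℕ} {ζ : ℂ} (hζ : IsPrimitiveRoot ζ N)
    {α β : Fin n → ℕ} (hα : ∀ j, α j < N) (hβ : ∀ j, β j < N) :
    ∑ g ∈ Fintype.piFinset (fun _ : Fin n => Finset.range N),
      mpow (fun j => ζ ^ g j) β * mpow (fun j => (ζ ^ g j)⁻¹) α =
      if β = α then (N : ℂ) ^ n else 0 := by
  simp_rw [mpow, ← Finset.prod_mul_distrib]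
  rw [Finset.sum_prod_piFinset (Finset.range N)
    (fun (j : Fin n) k => (ζ ^ k) ^ β j * ((ζ ^ k)⁻¹) ^ α j)]
  simp_rw [fun j => sum_primitiveRoot_pow_mul_inv_pow hζ (hα j) (hβ j)]
  split_ifs with h
  · subst h
    simp
  · obtain ⟨j, hj⟩ := Function.ne_iff.mp h
    exact Finset.prod_eq_zero (Finset.mem_univ j) (if_neg hj)

/-- Cauchy's estimate for the coefficients of a polynomial bounded on a torus. -/
theorem norm_coeff_mul_pow_le_of_polynomial {n : ℕ} {X : Type*} [NormedAddCommGroup X]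
    [NormedSpace ℂ X] {a : (Fin n → ℕ) → X} {s : Finset (Fin n → ℕ)} {t C : ℝ} (ht : 0 ≤ t)
    (hC : ∀ z : Fin n → ℂ, (∀ j, ‖z j‖ = t) → ‖∑ β ∈ s, mpow z β • a β‖ ≤ C)
    {α : Fin n → ℕ} (hα : α ∈ s) : ‖a α‖ * t ^ ∑ j, α j ≤ C := by
  obtain ⟨N, hN⟩ : ∃ N : ℕ, ∀ β ∈ s, ∀ j, β j < N := by
    refine ⟨(s.sup fun β => ∑ j, β j) + 1, fun β hβ j => Nat.lt_succ_of_le ?_⟩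
    exact (Finset.single_le_sum (f := β) (fun _ _ => Nat.zero_le _) (Finset.mem_univ j)).trans
      (Finset.le_sup (f := fun β : Fin n → ℕ => ∑ j, β j) hβ)
  have hN0 : N + 1 ≠ 0 := by omega
  have hζ := Complex.isPrimitiveRoot_exp (N + 1) hN0
  set ζ := Complex.exp (2 * Real.pi * Complex.I / ((N + 1 : ℕ) : ℂ))
  have hζ1 : ‖ζ‖ = 1 := hζ.norm'_eq_one hN0
  set G := Fintype.piFinset (fun _ : Fin n => Finset.range (N + 1))
  have havg : ∑ g ∈ G, mpow (fun j => (ζ ^ g j)⁻¹) α •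
      ∑ β ∈ s, mpow (fun j => ζ ^ g j * (t : ℂ)) β • a β =
      ((N + 1 : ℕ) : ℂ) ^ n • mpow (fun _ => (t : ℂ)) α • a α := by
    simp_rw [Finset.smul_sum]
    rw [Finset.sum_comm, Finset.sum_eq_single α]
    · simp_rw [mpow_mul, smul_smul, ← Finset.sum_smul]
      rw [← if_pos (c := α = α) (t := ((N + 1 : ℕ) : ℂ) ^ n) (e := 0) rfl,
        ← sum_mpow_mul_mpow_inv hζ (fun j => (hN α hα j).trans (Nat.lt_succ_self N))
          (fun j => (hN α hα j).trans (Nat.lt_succ_self N)), Finset.sum_mul]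
      congr 1
      exact Finset.sum_congr rfl fun g _ => by ring
    · intro β hβ hne
      simp_rw [mpow_mul, smul_smul, ← Finset.sum_smul]
      have h0 := sum_mpow_mul_mpow_inv hζ (fun j => (hN α hα j).trans (Nat.lt_succ_self N))
          (fun j => (hN β hβ j).trans (Nat.lt_succ_self N))
      rw [if_neg hne] at h0
      convert zero_smul ℂ (a β)
      rw [← zero_mul (mpow (fun _ => (t : ℂ)) β), ← h0, Finset.sum_mul]
      exact Finset.sum_congr rfl fun g _ => by ring
    · exact fun h => absurd hα h
  have hle : ‖∑ g ∈ G, mpow (fun j => (ζ ^ g j)⁻¹) α •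
      ∑ β ∈ s, mpow (fun j => ζ ^ g j * (t : ℂ)) β • a β‖ ≤ ∑ _g ∈ G, C := by
    refine norm_sum_le_of_le _ fun g _ => ?_
    rw [norm_smul, norm_mpow_of_norm_eq (t := 1) (fun j => by simp [hζ1]), one_pow, one_mul]
    exact hC _ fun j => by simp [hζ1, abs_of_nonneg ht]
  have ht' : ‖mpow (fun _ : Fin n => (t : ℂ)) α‖ = t ^ ∑ j, α j :=
    norm_mpow_of_norm_eq (fun _ => by simp [abs_of_nonneg ht]) α
  rw [havg, norm_smul, norm_smul, ht', norm_pow, Complex.norm_natCast, Finset.sum_const,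
    Fintype.card_piFinset_const, Finset.card_range, nsmul_eq_mul, Nat.cast_pow] at hle
  rw [mul_comm]
  exact le_of_mul_le_mul_left hle (by positivity)

theorem le_supNorm {n : ℕ} {E : Type*} [NormedAddCommGroup E] {Ω : Set (Fin n → ℂ)}
    {f : (Fin n → ℂ) → E} (hf : BddAbove ((fun z => ‖f z‖) '' Ω)) {z : Fin n → ℂ} (hz : z ∈ Ω) :
    ‖f z‖ ≤ supNorm Ω f := by
  obtain ⟨C, hC⟩ := hf
  have hb : BddAbove (Set.range fun z => ⨆ _ : z ∈ Ω, ‖f z‖) := by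
    refine ⟨max C 0, ?_⟩
    rintro _ ⟨w, rfl⟩
    exact Real.iSup_le (fun hw => (hC ⟨w, hw, rfl⟩).trans (le_max_left _ _)) (le_max_right _ _)
  refine le_trans ?_ (le_ciSup hb z)
  simp [hz]

theorem supNorm_nonneg {n : ℕ} {E : Type*} [NormedAddCommGroup E] (Ω : Set (Fin n → ℂ))
    (f : (Fin n → ℂ) → E) : 0 ≤ supNorm Ω f :=
  Real.iSup_nonneg fun _ => Real.iSup_nonneg fun _ => norm_nonneg _

/-- Cauchy's estimate on a torus contained in a complete Reinhardt domain. -/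
theorem IsBddHolomorphic.norm_coeff_mul_pow_le {n : ℕ} {X : Type*} [NormedAddCommGroup X]
    [NormedSpace ℂ X] {Ω : Set (Fin n → ℂ)} (hR : IsCompleteReinhardt Ω)
    {f : (Fin n → ℂ) → X} {a : (Fin n → ℕ) → X} (hf : IsBddHolomorphic Ω f a) {t : ℝ}
    (ht : 0 ≤ t) (htΩ : (fun _ => (t : ℂ)) ∈ Ω) (α : Fin n → ℕ) :
    ‖a α‖ * t ^ ∑ j, α j ≤ supNorm Ω f := by
  refine le_of_forall_pos_le_add fun ε hε => ?_
  have hK : Metric.closedBall (0 : Fin n → ℂ) t ⊆ Ω := by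
    intro z hz
    rw [mem_closedBall_zero_iff, pi_norm_le_iff_of_nonneg ht] at hz
    exact hR.2.2 _ htΩ z fun j => by simpa [abs_of_nonneg ht] using hz j
  have hunif := (tendstoLocallyUniformlyOn_iff_forall_isCompact hR.1).mp hf.1 _ hK
    (isCompact_closedBall 0 t)
  obtain ⟨s, hs, hα⟩ := ((Metric.tendstoUniformlyOn_iff.mp hunif ε hε).and
    (eventually_ge_atTop {α})).exists
  refine norm_coeff_mul_pow_le_of_polynomial ht (fun z hz => ?_)
    (Finset.singleton_subset_iff.mp hα)
  have hzK : z ∈ Metric.closedBall (0 : Fin n → ℂ) t := by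
    rw [mem_closedBall_zero_iff, pi_norm_le_iff_of_nonneg ht]
    exact fun j => (hz j).le
  have h1 := hs z hzK
  rw [dist_comm, dist_eq_norm] at h1
  have h2 := norm_le_norm_add_norm_sub' (∑ β ∈ s, mpow z β • a β) (f z)
  have h3 := le_supNorm hf.2 (hK hzK)
  linarith

theorem tsum_ofReal_pow_sum_le {n : ℕ} {q C : ℝ} (hq : 0 ≤ q) (hq1 : q < 1) (hC : 0 ≤ C) :
    ∑' α : Fin n → ℕ, ENNReal.ofReal (C * q ^ ∑ j, α j) ≤
      ENNReal.ofReal (C * ((1 - q)⁻¹) ^ n) := by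
  rw [ENNReal.tsum_eq_iSup_sum]
  refine iSup_le fun s => ?_
  rw [← ENNReal.ofReal_sum_of_nonneg fun α _ => by positivity, ← Finset.mul_sum]
  refine ENNReal.ofReal_le_ofReal (mul_le_mul_of_nonneg_left ?_ hC)
  have hsub : s ⊆ Fintype.piFinset fun _ : Fin n =>
      Finset.range ((s.sup fun β => ∑ j, β j) + 1) := by
    intro β hβ
    refine Fintype.mem_piFinset.mpr fun j => Finset.mem_range.mpr (Nat.lt_succ_of_le ?_)
    exact (Finset.single_le_sum (f := β) (fun _ _ => Nat.zero_le _) (Finset.mem_univ j)).trans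
      (Finset.le_sup (f := fun β : Fin n → ℕ => ∑ j, β j) hβ)
  refine (Finset.sum_le_sum_of_subset_of_nonneg hsub fun _ _ _ => by positivity).trans ?_
  simp_rw [← Finset.prod_pow_eq_pow_sum]
  rw [Finset.sum_prod_piFinset (Finset.range _) (fun (_ : Fin n) k => q ^ k), Finset.prod_const,
    Finset.card_univ, Fintype.card_fin]
  refine pow_le_pow_left₀ (Finset.sum_nonneg fun _ _ => by positivity) ?_ n
  rw [← tsum_geometric_of_lt_one hq hq1]
  exact (summable_geometric_of_lt_one hq hq1).sum_le_tsum _ fun _ _ => by positivity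

theorem nonempty_setOf_subset_smul_polydisc {n : ℕ} {Ω : Set (Fin n → ℂ)}
    (hb : Bornology.IsBounded Ω) : {s : ℝ | 0 < s ∧ Ω ⊆ s • polydisc n}.Nonempty := by
  obtain ⟨C, hC, hsub⟩ := hb.subset_ball_lt 0 0
  refine ⟨C, hC, fun z hz => ?_⟩
  rw [Set.mem_smul_set_iff_inv_smul_mem₀ hC.ne']
  intro j
  have h1 := mem_ball_zero_iff.mp (hsub hz)
  have h2 := norm_le_pi_norm z j
  simp only [Pi.smul_apply, norm_smul, norm_inv, Real.norm_eq_abs, abs_of_pos hC]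
  rw [inv_mul_lt_one₀ hC]
  linarith

theorem nonempty_setOf_polydisc_subset_smul {n : ℕ} {Ω : Set (Fin n → ℂ)}
    (hR : IsCompleteReinhardt Ω) : {s : ℝ | 0 < s ∧ polydisc n ⊆ s • Ω}.Nonempty := by
  obtain ⟨w, hw⟩ := hR.2.1.nonempty
  have h0 : (0 : Fin n → ℂ) ∈ Ω := hR.2.2 w hw 0 fun j => by simp
  obtain ⟨ε, hε, hsub⟩ := Metric.isOpen_iff.mp hR.1 0 h0
  refine ⟨ε⁻¹, by positivity, fun z hz => ?_⟩
  rw [Set.mem_smul_set_iff_inv_smul_mem₀ (by positivity), inv_inv]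
  refine hsub ?_
  rw [mem_ball_zero_iff, pi_norm_lt_iff hε]
  intro j
  simp only [Pi.smul_apply, norm_smul, Real.norm_eq_abs, abs_of_pos hε]
  exact mul_lt_of_lt_one_right hε (hz j)

theorem one_le_mul_of_subset_smul {n : ℕ} (hn : 1 ≤ n) {Ω : Set (Fin n → ℂ)} {s t : ℝ}
    (hs : 0 < s) (ht : 0 < t) (h₁ : Ω ⊆ s • polydisc n) (h₂ : polydisc n ⊆ t • Ω) :
    1 ≤ s * t := by
  refine le_of_forall_lt_imp_le_of_dense fun u hu => ?_
  rcases le_or_gt u 0 with hu0 | hu0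
  · exact hu0.trans (by positivity)
  have hmem : (fun _ => (u : ℂ)) ∈ polydisc n := fun j => by simpa [abs_of_pos hu0] using hu
  obtain ⟨w, hw, hwu⟩ := h₂ hmem
  obtain ⟨v, hv, hvw⟩ := h₁ hw
  have hj := congrArg norm (congrFun hwu ⟨0, hn⟩)
  rw [← hvw] at hj
  simp only [Pi.smul_apply, norm_smul, Real.norm_eq_abs, abs_of_pos hs, abs_of_pos ht,
    Complex.norm_real, abs_of_pos hu0] at hj
  have := hv ⟨0, hn⟩
  rw [← hj, ← mul_assoc, mul_comm t s]
  exact mul_le_of_le_one_right (by positivity) this.le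

theorem SRatio_nonneg {n : ℕ} (Ω₁ Ω₂ : Set (Fin n → ℂ)) : 0 ≤ SRatio Ω₁ Ω₂ :=
  Real.sInf_nonneg fun _ hs => hs.1.le

theorem SRatio_pos_and_one_le_mul {n : ℕ} (hn : 1 ≤ n) {Ω : Set (Fin n → ℂ)}
    (hR : IsCompleteReinhardt Ω) (hb : Bornology.IsBounded Ω) :
    0 < SRatio (polydisc n) Ω ∧ 1 ≤ SRatio Ω (polydisc n) * SRatio (polydisc n) Ω := by
  have h : ∀ s, 0 < s → Ω ⊆ s • polydisc n → s⁻¹ ≤ SRatio (polydisc n) Ω := by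
    intro s hs hsub
    refine le_csInf (nonempty_setOf_polydisc_subset_smul hR) fun t ht => ?_
    rw [inv_le_iff_one_le_mul₀' hs]
    exact one_le_mul_of_subset_smul hn hs ht.1 hsub ht.2
  have hpos : 0 < SRatio (polydisc n) Ω := by
    obtain ⟨s, hs, hsub⟩ := nonempty_setOf_subset_smul_polydisc hb
    exact (inv_pos.mpr hs).trans_le (h s hs hsub)
  refine ⟨hpos, ?_⟩
  rw [← inv_le_iff_one_le_mul₀ hpos]
  refine le_csInf (nonempty_setOf_subset_smul_polydisc hb) fun s hs => ?_
  exact inv_le_of_inv_le₀ hs.1 (h s hs.1 hs.2)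

theorem norm_le_SRatio_polydisc {n : ℕ} {Ω : Set (Fin n → ℂ)} (hb : Bornology.IsBounded Ω)
    {z : Fin n → ℂ} (hz : z ∈ Ω) (j : Fin n) : ‖z j‖ ≤ SRatio Ω (polydisc n) := by
  refine le_csInf (nonempty_setOf_subset_smul_polydisc hb) fun s hs => ?_
  obtain ⟨v, hv, rfl⟩ := hs.2 hz
  simp only [Pi.smul_apply, norm_smul, Real.norm_eq_abs, abs_of_pos hs.1]
  exact mul_le_of_le_one_right hs.1.le (hv j).le

theorem const_mem_of_lt_inv_SRatio {n : ℕ} {Ω : Set (Fin n → ℂ)}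
    (hR : IsCompleteReinhardt Ω) {t : ℝ} (ht : 0 < t) (h : t < (SRatio (polydisc n) Ω)⁻¹) :
    (fun _ => (t : ℂ)) ∈ Ω := by
  have hS : SRatio (polydisc n) Ω < t⁻¹ := by
    rcases (SRatio_nonneg (polydisc n) Ω).eq_or_lt with h0 | h0
    · rw [← h0]
      positivity
    · exact (lt_inv_comm₀ ht h0).mp h
  obtain ⟨s, ⟨hs, hsub⟩, hst⟩ := exists_lt_of_csInf_lt (nonempty_setOf_polydisc_subset_smul hR) hS
  have hmem : (fun _ => ((s * t : ℝ) : ℂ)) ∈ polydisc n := by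
    intro j
    rw [Complex.norm_real, Real.norm_eq_abs, abs_of_pos (by positivity)]
    rwa [← one_div, lt_div_iff₀ ht] at hst
  obtain ⟨w, hw, hwu⟩ := hsub hmem
  convert hw using 1
  funext j
  have hj := congrFun hwu j
  simp only [Pi.smul_apply, Complex.real_smul, Complex.ofReal_mul] at hj
  exact (mul_left_cancel₀ (by exact_mod_cast hs.ne') hj).symm

/-- Cauchy's estimate in terms of the inner radius of the domain. -/
theorem IsBddHolomorphic.norm_coeff_le {n : ℕ} (hn : 1 ≤ n) {X : Type*}
    [NormedAddCommGroup X] [NormedSpace ℂ X] {Ω : Set (Fin n → ℂ)} (hR : IsCompleteReinhardt Ω)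
    (hb : Bornology.IsBounded Ω) {f : (Fin n → ℂ) → X} {a : (Fin n → ℕ) → X}
    (hf : IsBddHolomorphic Ω f a) (α : Fin n → ℕ) :
    ‖a α‖ ≤ supNorm Ω f * SRatio (polydisc n) Ω ^ ∑ j, α j := by
  have hS := (SRatio_pos_and_one_le_mul hn hR hb).1
  have hlim : Tendsto (fun t : ℝ => ‖a α‖ * t ^ ∑ j, α j)
      (nhdsWithin (SRatio (polydisc n) Ω)⁻¹ (Set.Iio (SRatio (polydisc n) Ω)⁻¹))
      (nhds (‖a α‖ * (SRatio (polydisc n) Ω)⁻¹ ^ ∑ j, α j)) :=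
    (Continuous.tendsto (by fun_prop) _).mono_left nhdsWithin_le_nhds
  have hle : ‖a α‖ * (SRatio (polydisc n) Ω)⁻¹ ^ ∑ j, α j ≤ supNorm Ω f := by
    refine le_of_tendsto hlim ?_
    filter_upwards [Ioo_mem_nhdsLT (inv_pos.mpr hS)] with t ht
    exact hf.norm_coeff_mul_pow_le hR ht.1.le (const_mem_of_lt_inv_SRatio hR ht.1 ht.2) α
  rwa [inv_pow, ← div_eq_mul_inv, div_le_iff₀ (by positivity)] at hle

theorem inv_one_sub_div_pow_le {n : ℕ} (hn : 1 ≤ n) {L : ℝ} (hL : 1 < L) :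
    ((1 - (L - 1) / L / n)⁻¹) ^ n ≤ L := by
  have hn' : (1 : ℝ) ≤ n := by exact_mod_cast hn
  have hx : (L - 1) / L < 1 := by
    rw [div_lt_one (by linarith)]
    linarith
  have hx0 : 0 ≤ (L - 1) / L := div_nonneg (by linarith) (by linarith)
  have hq : (L - 1) / L / n < 1 := (div_le_self hx0 hn').trans_lt hx
  have hB := one_add_mul_le_pow (a := -((L - 1) / L / n)) (by linarith) n
  have heq : 1 + (n : ℝ) * -((L - 1) / L / n) = L⁻¹ := by
    field_simp
    ring
  rw [heq, ← sub_eq_add_neg] at hB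
  rw [inv_pow]
  exact inv_le_of_inv_le₀ (by linarith) hB

/-- lower bound for the second Bohr radius of `X`-valued holomorphic functions
for the identity operator on `X`. -/
theorem second_bohr_Hol_lower_bound_id {n : ℕ} (hn : 1 ≤ n) (Ω : Set (Fin n → ℂ))
    (hR : IsCompleteReinhardt Ω) (hb : Bornology.IsBounded Ω)
    {X : Type*} [NormedAddCommGroup X] [NormedSpace ℂ X] [CompleteSpace X] [Nontrivial X]
    (p lam : ℝ) (hp : 1 ≤ p) (hlam : 1 < lam) :
    (lam ^ p - 1) ^ (1 / p) / lam * (n : ℝ) ^ (-(1 / p)) /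
        (SRatio Ω (polydisc n) * SRatio (polydisc n) Ω) ≤
      secondBohrHol Ω p lam (ContinuousLinearMap.id ℂ X) := by
  have hp0 : 0 < p := by linarith
  have hL : 1 < lam ^ p := Real.one_lt_rpow hlam hp0
  have hn' : (1 : ℝ) ≤ n := by exact_mod_cast hn
  obtain ⟨hS, hSS⟩ := SRatio_pos_and_one_le_mul hn hR hb
  have hS₁ : 0 < SRatio Ω (polydisc n) := pos_of_mul_pos_left (by linarith) hS.le
  set c : ℝ := (lam ^ p - 1) ^ (1 / p) / lam * (n : ℝ) ^ (-(1 / p)) with hc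
  have hc0 : 0 ≤ c := by
    have : 0 ≤ lam ^ p - 1 := by linarith
    positivity
  have hcp : c ^ p = (lam ^ p - 1) / lam ^ p / n := by
    have h0 : 0 ≤ lam ^ p - 1 := by linarith
    rw [hc, Real.mul_rpow (by positivity) (by positivity),
      Real.div_rpow (by positivity) (by positivity), ← Real.rpow_mul h0,
      ← Real.rpow_mul (by positivity), neg_mul, one_div_mul_cancel hp0.ne', Real.rpow_one,
      Real.rpow_neg_one, div_eq_mul_inv _ (n : ℝ)]
  have hcp1 : c ^ p < 1 := by
    rw [hcp]
    refine (div_le_self (div_nonneg (by linarith) (by linarith)) hn').trans_lt ?_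
    rw [div_lt_one (by linarith)]
    linarith
  have hc1 : c ≤ 1 := by
    by_contra! h
    exact absurd hcp1 (Real.one_lt_rpow h hp0).not_gt
  refine le_csSup ⟨1, fun r hr => hr.1.2⟩ ⟨⟨by positivity, ?_⟩, fun f a hf => ?_⟩
  · exact div_le_one_of_le₀ (hc1.trans hSS) (by positivity)
  have hM := supNorm_nonneg Ω f
  calc holBohrSum Ω _ p (ContinuousLinearMap.id ℂ X) a
      ≤ ∑' α : Fin n → ℕ, ENNReal.ofReal (supNorm Ω f ^ p * (c ^ p) ^ ∑ j, α j) := by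
        refine ENNReal.tsum_le_tsum fun α => iSup₂_le fun z hz => ENNReal.ofReal_le_ofReal ?_
        obtain ⟨w, hw, rfl⟩ := hz
        rw [ContinuousLinearMap.id_apply, ← Real.mul_rpow (norm_nonneg _) (norm_nonneg _),
          ← Real.rpow_natCast, ← Real.rpow_mul hc0, mul_comm p, Real.rpow_mul hc0,
          Real.rpow_natCast, ← Real.mul_rpow hM (by positivity)]
        refine Real.rpow_le_rpow (by positivity) ?_ hp0.le
        have hz : ∀ j, ‖((c / (SRatio Ω (polydisc n) * SRatio (polydisc n) Ω)) • w) j‖ ≤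
            c / SRatio (polydisc n) Ω := by
          intro j
          rw [Pi.smul_apply, norm_smul, Real.norm_eq_abs, abs_of_nonneg (by positivity)]
          refine (mul_le_mul_of_nonneg_left (norm_le_SRatio_polydisc hb hw j)
            (by positivity)).trans_eq ?_
          field_simp
        refine (mul_le_mul (hf.norm_coeff_le hn hR hb α) (norm_mpow_le hz α) (norm_nonneg _)
          (by positivity)).trans_eq ?_
        rw [mul_assoc, ← mul_pow, mul_div_cancel₀ _ hS.ne']
    _ ≤ ENNReal.ofReal (supNorm Ω f ^ p * ((1 - c ^ p)⁻¹) ^ n) :=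
        tsum_ofReal_pow_sum_le (by positivity) hcp1 (by positivity)
    _ ≤ ENNReal.ofReal (lam ^ p * supNorm Ω f ^ p) := by
        refine ENNReal.ofReal_le_ofReal ?_
        rw [mul_comm, hcp]
        exact mul_le_mul_of_nonneg_right (inv_one_sub_div_pow_le hn hL) (by positivity)

end BohrPaper
end
end

section
/- Let H be a nonzero finite-dimensional complex Hilbert space and X := B(H). There exists a constant E₁ > 0, depending only on X, such that for every n ≥ 1, every complex Banach space Z = (ℂⁿ,‖·‖) whose canonical basis is normalized and 1-unconditional, every λ > 1 and every 1 ≤ q ≤ ∞ (with 1/q := 0 when q = ∞), writing s := ‖Id : Z → ℓⁿ_q‖ and t := ‖Id : ℓⁿ_q → Z‖, the second λ-powered Bohr radius for the identity operator on X satisfies L_λ(B_Z,1,X) ≥ E₁ · (1/(s·t·n^{1/q})) · max{ 1/(√n · ‖Id : ℓⁿ_2 → Z‖), 1/(e · ‖Id : Z → ℓⁿ_1‖) } · (λ − 1)/(2λ − 1). -/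
open scoped ENNReal Pointwise
open Filter

noncomputable section

namespace BohrPaper

section Pluriharmonic

variable {n : ℕ} {H : Type*} [NormedAddCommGroup H] [InnerProductSpace ℂ H] [CompleteSpace H]
  {Y : Type*} [NormedAddCommGroup Y] [NormedSpace ℂ Y]

/-- `f` is a bounded pluriharmonic `B(H)`-valued function on `Ω`, given by coefficient
families `a`, `b` (with `b 0 = 0`): `f = Σ a_α z^α + Σ (b_α)* z̄^α`, both power series
converging locally uniformly on `Ω`, and `f` bounded on `Ω`. -/
def IsBddPluriharmonic (Ω : Set (Fin n → ℂ)) (f : (Fin n → ℂ) → H →L[ℂ] H)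
    (a b : (Fin n → ℕ) → H →L[ℂ] H) : Prop :=
  b 0 = 0 ∧
    (∃ h g : (Fin n → ℂ) → H →L[ℂ] H,
      TendstoLocallyUniformlyOn
        (fun (s : Finset (Fin n → ℕ)) z => ∑ α ∈ s, mpow z α • a α) h atTop Ω ∧
      TendstoLocallyUniformlyOn
        (fun (s : Finset (Fin n → ℕ)) z =>
          ∑ α ∈ s, mpow (star z) α • ContinuousLinearMap.adjoint (b α)) g atTop Ω ∧
      ∀ z ∈ Ω, f z = h z + g z) ∧
    BddAbove ((fun z => ‖f z‖) '' Ω)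

/-- The left-hand side `Σ_α sup_{z ∈ rΩ} (‖U a_α‖^p + ‖U b_α‖^p)|z^α|^p` of the second
Bohr inequality for pluriharmonic functions, valued in `ℝ≥0∞`. -/
def phBohrSum (Ω : Set (Fin n → ℂ)) (r p : ℝ) (U : (H →L[ℂ] H) →L[ℂ] Y)
    (a b : (Fin n → ℕ) → H →L[ℂ] H) : ℝ≥0∞ :=
  ∑' α : Fin n → ℕ, ⨆ z ∈ r • Ω,
    ENNReal.ofReal ((‖U (a α)‖ ^ p + ‖U (b α)‖ ^ p) * ‖mpow z α‖ ^ p)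

/-- The second `λ`-powered Bohr radius `L_λ(Ω, p, U)` for pluriharmonic functions. -/
def secondBohrPH (Ω : Set (Fin n → ℂ)) (p lam : ℝ) (U : (H →L[ℂ] H) →L[ℂ] Y) : ℝ :=
  sSup {r : ℝ | r ∈ Set.Icc (0 : ℝ) 1 ∧
    ∀ (f : (Fin n → ℂ) → H →L[ℂ] H) (a b : (Fin n → ℕ) → H →L[ℂ] H),
      IsBddPluriharmonic Ω f a b →
      phBohrSum Ω r p U a b ≤ ENNReal.ofReal (lam ^ p * supNorm Ω f ^ p)}

end Pluriharmonic

open MeasureTheory in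
/-- The circle carries its normalized Haar measure, as in Mathlib's multivariate Fourier theory. -/
local instance instMeasureSpaceCircle : MeasureSpace UnitAddCircle := ⟨AddCircle.haarAddCircle⟩

open MeasureTheory in
local instance instProbCircle : IsProbabilityMeasure (volume : Measure UnitAddCircle) :=
  inferInstanceAs (IsProbabilityMeasure AddCircle.haarAddCircle)

open UnitAddTorus in
/-- Parseval's inequality for a bounded trigonometric polynomial. -/
theorem sum_norm_sq_le_of_trig_poly_bound {n : ℕ} {ι : Type*} (g : ι → Fin n → ℤ)
    (hg : Function.Injective g) (T : Finset ι) (c : ι → ℂ) (C : ℝ) (hC : 0 ≤ C)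
    (h : ∀ θ : UnitAddTorus (Fin n), ‖∑ i ∈ T, c i * mFourier (g i) θ‖ ≤ C) :
    ∑ i ∈ T, ‖c i‖ ^ 2 ≤ C ^ 2 := by
  have ho := (orthonormal_mFourier (d := Fin n)).comp g hg
  have hs := ho.inner_sum c c T
  set p : C(UnitAddTorus (Fin n), ℂ) := ∑ i ∈ T, c i • mFourier (g i) with hp
  have hpL : ∑ i ∈ T, c i • (mFourierLp 2 ∘ g) i
      = ContinuousMap.toLp (E := ℂ) 2 MeasureTheory.volume ℂ p := by
    simp [hp, mFourierLp]
  have hpn : ‖p‖ ≤ C := by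
    rw [ContinuousMap.norm_le _ hC]
    intro θ
    simpa [hp, ContinuousMap.sum_apply] using h θ
  rw [hpL, inner_self_eq_norm_sq_to_K] at hs
  have hs' : ‖ContinuousMap.toLp (E := ℂ) 2 MeasureTheory.volume ℂ p‖ ^ 2 = ∑ i ∈ T, ‖c i‖ ^ 2 := by
    have : ((‖ContinuousMap.toLp (E := ℂ) 2 MeasureTheory.volume ℂ p‖ ^ 2 : ℝ) : ℂ)
        = ((∑ i ∈ T, ‖c i‖ ^ 2 : ℝ) : ℂ) := by
      push_cast
      simpa [Complex.conj_mul'] using hs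
    exact_mod_cast this
  rw [← hs']
  have h1 := (ContinuousMap.toLp (E := ℂ) 2 (MeasureTheory.volume : MeasureTheory.Measure (UnitAddTorus (Fin n))) ℂ).le_opNorm p
  have h2 := ContinuousMap.toLp_norm_le (p := 2) (E := ℂ) (MeasureTheory.volume : MeasureTheory.Measure (UnitAddTorus (Fin n))) (𝕜 := ℂ)
  have h3 : ((MeasureTheory.measureUnivNNReal (MeasureTheory.volume : MeasureTheory.Measure (UnitAddTorus (Fin n)))  : NNReal) : ℝ) = 1 := by
    simp [MeasureTheory.measureUnivNNReal]
  rw [h3] at h2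
  rw [Real.one_rpow] at h2
  gcongr
  calc _ ≤ _ := h1
    _ ≤ 1 * C := by gcongr
    _ = C := one_mul C

open UnitAddTorus in
theorem sum_norm_sq_add_le_of_harmonic_poly_bound {n : ℕ} (S : Finset (Fin n → ℕ))
    (A B : (Fin n → ℕ) → ℂ) (hB : B 0 = 0) (C : ℝ) (hC : 0 ≤ C)
    (h : ∀ θ : UnitAddTorus (Fin n), ‖∑ α ∈ S, A α * mFourier (fun j => (α j : ℤ)) θ +
      ∑ α ∈ S, B α * mFourier (-fun j => (α j : ℤ)) θ‖ ≤ C) :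
    ∑ α ∈ S, (‖A α‖ ^ 2 + ‖B α‖ ^ 2) ≤ C ^ 2 := by
  classical
  let g : (Fin n → ℕ) ⊕ {α : Fin n → ℕ // α ≠ 0} → Fin n → ℤ :=
    Sum.elim (fun α j => (α j : ℤ)) (fun α j => -(α.1 j : ℤ))
  have hg : Function.Injective g := by
    rintro (x | x) (y | y) hxy
    · congr 1; funext j; simpa [g] using congrFun hxy j
    · exfalso; apply y.2; funext j
      have := congrFun hxy j
      simp only [g, Sum.elim_inl, Sum.elim_inr] at this
      simp only [Pi.zero_apply]; omega
    · exfalso; apply x.2; funext j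
      have := congrFun hxy j
      simp only [g, Sum.elim_inl, Sum.elim_inr] at this
      simp only [Pi.zero_apply]; omega
    · congr 1; apply Subtype.ext; funext j; simpa [g] using congrFun hxy j
  have hsub : ∀ {E : Type} [AddCommMonoid E] (F : (Fin n → ℕ) → E), F 0 = 0 →
      ∑ α ∈ S.subtype (· ≠ 0), F α.1 = ∑ α ∈ S, F α := by
    intro E _ F hF
    rw [Finset.sum_subtype_eq_sum_filter, Finset.sum_filter]
    refine Finset.sum_congr rfl fun α _ => ?_
    split_ifs with h0
    · rfl
    · rw [not_not.1 h0, hF]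
  have := sum_norm_sq_le_of_trig_poly_bound g hg (S.disjSum (S.subtype (· ≠ 0)))
    (Sum.elim A (fun α => B α.1)) C hC ?_
  · rw [Finset.sum_disjSum] at this
    simp only [Sum.elim_inl, Sum.elim_inr] at this
    rwa [hsub (fun α => ‖B α‖ ^ 2) (by simp [hB]), ← Finset.sum_add_distrib] at this
  · intro θ
    rw [Finset.sum_disjSum]
    have e := hsub (fun α => B α * mFourier (-fun j => (α j : ℤ)) θ) (by simp [hB])
    have h' := h θ
    rw [← e] at h'
    exact h'

section Parseval

variable {n : ℕ} {H : Type*} [NormedAddCommGroup H] [InnerProductSpace ℂ H] [CompleteSpace H]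

theorem mpow_mul_fourier (ρ : Fin n → ℂ) (θ : UnitAddTorus (Fin n)) (α : Fin n → ℕ) :
    mpow (fun j => ρ j * fourier 1 (θ j)) α =
      mpow ρ α * UnitAddTorus.mFourier (fun j => (α j : ℤ)) θ := by
  simp only [mpow, UnitAddTorus.mFourier, ContinuousMap.coe_mk, mul_pow, Finset.prod_mul_distrib]
  congr 1
  refine Finset.prod_congr rfl fun j _ => ?_
  rw [fourier_apply, fourier_apply, ← Circle.coe_pow, ← AddCircle.toCircle_nsmul]
  simp

theorem mpow_star (z : Fin n → ℂ) (α : Fin n → ℕ) : mpow (star z) α = star (mpow z α) := by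
  simp [mpow]

theorem norm_mpow (z : Fin n → ℂ) (α : Fin n → ℕ) : ‖mpow z α‖ = ∏ j, ‖z j‖ ^ α j := by
  simp [mpow]

/-- Parseval's inequality for the matrix entries of a bounded pluriharmonic function. -/
theorem sum_mpow_mul_inner_le {Ω : Set (Fin n → ℂ)}
    (hΩ : ∀ z ∈ Ω, ∀ w : Fin n → ℂ, (∀ j, ‖w j‖ ≤ ‖z j‖) → w ∈ Ω)
    {f : (Fin n → ℂ) → H →L[ℂ] H} {a b : (Fin n → ℕ) → H →L[ℂ] H}
    (hf : IsBddPluriharmonic Ω f a b) {M : ℝ} (hM : ∀ z ∈ Ω, ‖f z‖ ≤ M)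
    {ρ : Fin n → ℂ} (hρ : ρ ∈ Ω) {u v : H} (hu : ‖u‖ ≤ 1) (hv : ‖v‖ ≤ 1)
    (S : Finset (Fin n → ℕ)) :
    ∑ α ∈ S, ‖mpow ρ α‖ ^ 2 * (‖inner ℂ u (a α v)‖ ^ 2 +
      ‖inner ℂ u (ContinuousLinearMap.adjoint (b α) v)‖ ^ 2) ≤ M ^ 2 := by
  obtain ⟨hb0, ⟨h, g, hh, hg, hfg⟩, -⟩ := hf
  have hM0 : 0 ≤ M := (norm_nonneg _).trans (hM ρ hρ)
  set γ : UnitAddTorus (Fin n) → Fin n → ℂ := fun θ j => ρ j * fourier 1 (θ j) with hγ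
  have hγc : Continuous γ := by fun_prop
  have hγΩ : ∀ θ, γ θ ∈ Ω := fun θ => hΩ ρ hρ _ fun j => by
    simp only [hγ, norm_mul, fourier_apply]
    rw [Circle.norm_coe, mul_one]
  have hK : IsCompact (Set.range γ) := isCompact_range hγc
  have hKΩ : Set.range γ ⊆ Ω := by rintro _ ⟨θ, rfl⟩; exact hγΩ θ
  have hh' := (tendstoLocallyUniformlyOn_iff_tendstoUniformlyOn_of_compact hK).1 (hh.mono hKΩ)
  have hg' := (tendstoLocallyUniformlyOn_iff_tendstoUniformlyOn_of_compact hK).1 (hg.mono hKΩ)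
  rw [Metric.tendstoUniformlyOn_iff] at hh' hg'
  have key : ∀ ε > 0, ∑ α ∈ S, ‖mpow ρ α‖ ^ 2 * (‖inner ℂ u (a α v)‖ ^ 2 +
      ‖inner ℂ u (ContinuousLinearMap.adjoint (b α) v)‖ ^ 2) ≤ (M + (ε + ε)) ^ 2 := by
    intro ε hε
    obtain ⟨T, ⟨hT1, hT2⟩, hST⟩ :=
      (((hh' ε hε).and (hg' ε hε)).and (eventually_ge_atTop S)).exists
    refine (Finset.sum_le_sum_of_subset_of_nonneg hST fun _ _ _ => by positivity).trans ?_
    have := sum_norm_sq_add_le_of_harmonic_poly_bound T (fun α => mpow ρ α * inner ℂ u (a α v))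
      (fun α => star (mpow ρ α) * inner ℂ u (ContinuousLinearMap.adjoint (b α) v))
      (by simp [hb0]) (M + (ε + ε)) (by positivity) ?_
    · refine le_trans (le_of_eq ?_) this
      refine Finset.sum_congr rfl fun α _ => ?_
      rw [norm_mul, norm_mul, norm_star]
      ring
    · intro θ
      have e1 := hT1 (γ θ) ⟨θ, rfl⟩
      have e2 := hT2 (γ θ) ⟨θ, rfl⟩
      set P := ∑ α ∈ T, mpow (γ θ) α • a α with hP
      set Q := ∑ α ∈ T, mpow (star (γ θ)) α • ContinuousLinearMap.adjoint (b α) with hQ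
      have hPQ : ‖P + Q‖ ≤ M + (ε + ε) := by
        have : P + Q = f (γ θ) - ((h (γ θ) - P) + (g (γ θ) - Q)) := by
          rw [hfg _ (hγΩ θ)]; abel
        rw [this]
        rw [dist_eq_norm] at e1 e2
        exact (norm_sub_le _ _).trans (add_le_add (hM _ (hγΩ θ))
          ((norm_add_le _ _).trans (add_le_add e1.le e2.le)))
      have hrepr : ∑ α ∈ T, mpow ρ α * inner ℂ u (a α v) *
            UnitAddTorus.mFourier (fun j => (α j : ℤ)) θ +
          ∑ α ∈ T, star (mpow ρ α) * inner ℂ u (ContinuousLinearMap.adjoint (b α) v) *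
            UnitAddTorus.mFourier (-fun j => (α j : ℤ)) θ = inner ℂ u ((P + Q) v) := by
        rw [add_apply, inner_add_right, hP, hQ]
        simp only [sum_apply, smul_apply, inner_sum,
          inner_smul_right]
        congr 1
        · refine Finset.sum_congr rfl fun α _ => ?_
          rw [hγ, mpow_mul_fourier]; ring
        · refine Finset.sum_congr rfl fun α _ => ?_
          rw [mpow_star, hγ, mpow_mul_fourier, UnitAddTorus.mFourier_neg, star_mul',
            starRingEnd_apply]
          ring
      rw [hrepr]
      calc ‖inner ℂ u ((P + Q) v)‖ ≤ ‖u‖ * ‖(P + Q) v‖ := norm_inner_le_norm _ _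
        _ ≤ 1 * (‖P + Q‖ * ‖v‖) := by
          gcongr; exact (P + Q).le_opNorm v
        _ ≤ 1 * (‖P + Q‖ * 1) := by gcongr
        _ ≤ _ := by simpa using hPQ
  have hlim : Tendsto (fun ε : ℝ => (M + (ε + ε)) ^ 2) (nhdsWithin 0 (Set.Ioi 0))
      (nhds (M ^ 2)) := by
    have : Continuous fun ε : ℝ => (M + (ε + ε)) ^ 2 := by fun_prop
    simpa using (this.tendsto 0).mono_left nhdsWithin_le_nhds
  exact ge_of_tendsto hlim (by filter_upwards [self_mem_nhdsWithin] with ε hε using key ε hε)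

theorem norm_coeff_zero_le {Ω : Set (Fin n → ℂ)}
    (hΩ : ∀ z ∈ Ω, ∀ w : Fin n → ℂ, (∀ j, ‖w j‖ ≤ ‖z j‖) → w ∈ Ω) (h0 : (0 : Fin n → ℂ) ∈ Ω)
    {f : (Fin n → ℂ) → H →L[ℂ] H} {a b : (Fin n → ℕ) → H →L[ℂ] H}
    (hf : IsBddPluriharmonic Ω f a b) {M : ℝ} (hM : ∀ z ∈ Ω, ‖f z‖ ≤ M) :
    ‖a 0‖ ≤ M := by
  have hM0 : 0 ≤ M := (norm_nonneg _).trans (hM 0 h0)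
  refine ContinuousLinearMap.opNorm_le_of_unit_norm hM0 fun v hv => ?_
  by_cases hav : a 0 v = 0
  · simpa [hav] using hM0
  have hn : ‖a 0 v‖ ≠ 0 := norm_ne_zero_iff.2 hav
  have hu : ‖((‖a 0 v‖⁻¹ : ℝ) : ℂ) • a 0 v‖ ≤ 1 := by
    rw [norm_smul, Complex.norm_real, norm_inv, norm_norm, inv_mul_cancel₀ hn]
  have := sum_mpow_mul_inner_le hΩ hf hM h0 hu hv.le {0}
  have hb := hf.1
  simp only [Finset.sum_singleton, hb, map_zero, zero_apply, inner_zero_right,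
    norm_zero, inner_smul_left, Complex.conj_ofReal, norm_mul, Complex.norm_real, norm_inv,
    norm_norm, inner_self_eq_norm_sq_to_K] at this
  have e : ‖mpow (0 : Fin n → ℂ) 0‖ = 1 := by simp [mpow]
  rw [e] at this
  have h2 : ‖a 0 v‖ ^ 2 ≤ M ^ 2 := by
    refine le_trans (le_of_eq ?_) this
    simp
    field_simp
  exact le_of_sq_le_sq h2 hM0

end Parseval

section FiniteDimensional

variable {H : Type*} [NormedAddCommGroup H] [InnerProductSpace ℂ H]

theorem norm_sq_le_sum_inner {ι : Type*} [Fintype ι] (e : OrthonormalBasis ι ℂ H) (T : H →L[ℂ] H) :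
    ‖T‖ ^ 2 ≤ ∑ i, ∑ j, ‖inner ℂ (e i) (T (e j))‖ ^ 2 := by
  rw [Finset.sum_comm]
  simp only [e.sum_sq_norm_inner_right]
  have h0 : 0 ≤ ∑ j, ‖T (e j)‖ ^ 2 := by positivity
  rw [← Real.le_sqrt (norm_nonneg _) h0]
  refine T.opNorm_le_bound (Real.sqrt_nonneg _) fun v => ?_
  refine le_of_sq_le_sq ?_ (by positivity)
  rw [mul_pow, Real.sq_sqrt h0]
  have h1 : ‖T v‖ ≤ ∑ j, ‖T (e j)‖ * ‖inner ℂ (e j) v‖ := by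
    conv_lhs => rw [← e.sum_repr' v, map_sum]
    refine (norm_sum_le _ _).trans (Finset.sum_le_sum fun j _ => ?_)
    rw [map_smul, norm_smul, mul_comm]
  calc ‖T v‖ ^ 2 ≤ (∑ j, ‖T (e j)‖ * ‖inner ℂ (e j) v‖) ^ 2 := by gcongr
    _ ≤ _ := Finset.sum_mul_sq_le_sq_mul_sq _ _ _
    _ = _ := by rw [e.sum_sq_norm_inner_right]

variable {n : ℕ} [CompleteSpace H] [FiniteDimensional ℂ H]

/-- Parseval's inequality for a bounded pluriharmonic function on a finite-dimensional space. -/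
theorem sum_mpow_mul_norm_sq_le {Ω : Set (Fin n → ℂ)}
    (hΩ : ∀ z ∈ Ω, ∀ w : Fin n → ℂ, (∀ j, ‖w j‖ ≤ ‖z j‖) → w ∈ Ω)
    {f : (Fin n → ℂ) → H →L[ℂ] H} {a b : (Fin n → ℕ) → H →L[ℂ] H}
    (hf : IsBddPluriharmonic Ω f a b) {M : ℝ} (hM : ∀ z ∈ Ω, ‖f z‖ ≤ M)
    {ρ : Fin n → ℂ} (hρ : ρ ∈ Ω) (S : Finset (Fin n → ℕ)) :
    ∑ α ∈ S, ‖mpow ρ α‖ ^ 2 * (‖a α‖ ^ 2 + ‖b α‖ ^ 2) ≤ (Module.finrank ℂ H * M) ^ 2 := by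
  set e := stdOrthonormalBasis ℂ H
  calc ∑ α ∈ S, ‖mpow ρ α‖ ^ 2 * (‖a α‖ ^ 2 + ‖b α‖ ^ 2)
      ≤ ∑ α ∈ S, ∑ i, ∑ j, ‖mpow ρ α‖ ^ 2 * (‖inner ℂ (e i) (a α (e j))‖ ^ 2 +
          ‖inner ℂ (e i) (ContinuousLinearMap.adjoint (b α) (e j))‖ ^ 2) := by
        refine Finset.sum_le_sum fun α _ => ?_
        simp only [← Finset.mul_sum, Finset.sum_add_distrib]
        gcongr
        · exact norm_sq_le_sum_inner e _
        · rw [← LinearIsometryEquiv.norm_map ContinuousLinearMap.adjoint (b α)]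
          exact norm_sq_le_sum_inner e _
    _ = ∑ i, ∑ j, ∑ α ∈ S, ‖mpow ρ α‖ ^ 2 * (‖inner ℂ (e i) (a α (e j))‖ ^ 2 +
          ‖inner ℂ (e i) (ContinuousLinearMap.adjoint (b α) (e j))‖ ^ 2) := by
        rw [Finset.sum_comm]
        refine Finset.sum_congr rfl fun i _ => ?_
        rw [Finset.sum_comm]
    _ ≤ ∑ _i : Fin (Module.finrank ℂ H), ∑ _j : Fin (Module.finrank ℂ H), M ^ 2 := by
        gcongr with i _ j _
        exact sum_mpow_mul_inner_le hΩ hf hM hρ (e.norm_eq_one i).le (e.norm_eq_one j).le S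
    _ = _ := by simp; ring

end FiniteDimensional

theorem sum_prod_div_pow_le {n : ℕ} (hn : 1 ≤ n) {δ : ℝ} (h0 : 0 ≤ δ) (h1 : δ ≤ 1 / 2)
    (S : Finset (Fin n → ℕ)) (hS : 0 ∉ S) :
    ∑ α ∈ S, ∏ j, (δ / n) ^ α j ≤ 2 * δ := by
  classical
  have hn' : (1 : ℝ) ≤ n := by exact_mod_cast hn
  set x := δ / n with hx
  have hx0 : 0 ≤ x := by positivity
  have hxδ : x ≤ δ := div_le_self h0 hn'
  obtain ⟨K, hK⟩ : ∃ K : ℕ, insert 0 S ⊆ Fintype.piFinset fun _ : Fin n => Finset.range K := by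
    refine ⟨(insert 0 S).sup (fun α => Finset.univ.sup α) + 1, fun α hα => ?_⟩
    rw [Fintype.mem_piFinset]
    intro j
    rw [Finset.mem_range, Nat.lt_succ_iff]
    exact (Finset.le_sup (f := α) (Finset.mem_univ j)).trans
      (Finset.le_sup (f := fun α : Fin n → ℕ => Finset.univ.sup α) hα)
  have h2 : ∑ α ∈ insert 0 S, ∏ j, x ^ α j ≤ ((1 - x)⁻¹) ^ n := by
    refine (Finset.sum_le_sum_of_subset_of_nonneg hK fun _ _ _ => by positivity).trans ?_
    rw [Finset.sum_prod_piFinset (Finset.range K) (fun (_ : Fin n) (k : ℕ) => x ^ k)]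
    rw [Finset.prod_const, Finset.card_univ, Fintype.card_fin]
    gcongr
    have hs := (summable_geometric_of_lt_one hx0 (by linarith)).sum_le_tsum (Finset.range K)
      (fun _ _ => by positivity)
    rwa [tsum_geometric_of_lt_one hx0 (by linarith)] at hs
  rw [Finset.sum_insert hS] at h2
  simp only [Pi.zero_apply, pow_zero, Finset.prod_const_one] at h2
  have h3 : 1 - δ ≤ (1 - x) ^ n := by
    have := one_add_mul_le_pow (a := -x) (by linarith) n
    have e : (n : ℝ) * -x = -δ := by rw [hx]; field_simp
    rw [e] at this
    simpa [sub_eq_add_neg] using this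
  have h4 : ((1 - x)⁻¹) ^ n ≤ 1 + 2 * δ := by
    rw [inv_pow]
    refine (inv_anti₀ (by linarith) h3).trans ?_
    rw [inv_le_comm₀ (by linarith) (by linarith), inv_le_iff_one_le_mul₀ (by linarith)]
    nlinarith
  linarith

section Radius

variable {n : ℕ} {H : Type*} [NormedAddCommGroup H] [InnerProductSpace ℂ H] [CompleteSpace H]

theorem le_secondBohrPH_one {Ω : Set (Fin n → ℂ)}
    (hΩ : ∀ z ∈ Ω, ∀ w : Fin n → ℂ, (∀ j, ‖w j‖ ≤ ‖z j‖) → w ∈ Ω) (h0 : (0 : Fin n → ℂ) ∈ Ω)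
    {r lam : ℝ} (hr : r ∈ Set.Icc (0 : ℝ) 1)
    (hc : ∀ (f : (Fin n → ℂ) → H →L[ℂ] H) (a b : (Fin n → ℕ) → H →L[ℂ] H) (M : ℝ),
      IsBddPluriharmonic Ω f a b → (∀ z ∈ Ω, ‖f z‖ ≤ M) → ∃ c : (Fin n → ℕ) → ℝ,
        (∀ α, ∀ z ∈ r • Ω, (‖a α‖ + ‖b α‖) * ‖mpow z α‖ ≤ c α) ∧
        ∀ S : Finset (Fin n → ℕ), 0 ∉ S → ∑ α ∈ S, c α ≤ (lam - 1) * M) :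
    r ≤ secondBohrPH Ω 1 lam (ContinuousLinearMap.id ℂ (H →L[ℂ] H)) := by
  classical
  refine le_csSup ⟨1, fun x hx => hx.1.2⟩ ⟨hr, fun f a b hf => ?_⟩
  obtain ⟨B, hB⟩ := hf.2.2
  have hB' : ∀ z ∈ Ω, ‖f z‖ ≤ B := fun z hz => hB ⟨z, hz, rfl⟩
  have hB0 : 0 ≤ B := (norm_nonneg _).trans (hB' 0 h0)
  have hM : ∀ z ∈ Ω, ‖f z‖ ≤ supNorm Ω f := by
    intro z hz
    have hbdd : BddAbove (Set.range fun z => ⨆ _ : z ∈ Ω, ‖f z‖) := by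
      refine ⟨B, ?_⟩
      rintro _ ⟨w, rfl⟩
      exact Real.iSup_le (fun hw => hB' w hw) hB0
    refine le_trans (le_of_eq ?_) (le_ciSup hbdd z)
    simp [hz]
  set M := supNorm Ω f
  obtain ⟨c, hc1, hc2⟩ := hc f a b M hf hM
  have hr0 : (0 : Fin n → ℂ) ∈ r • Ω := ⟨0, h0, by simp⟩
  have hc0 : ∀ α, 0 ≤ c α := fun α => (by positivity : (0 : ℝ) ≤ _).trans (hc1 α 0 hr0)
  have ha0 := norm_coeff_zero_le hΩ h0 hf hM
  let c' : (Fin n → ℕ) → ℝ := fun α => if α = 0 then ‖a 0‖ else c α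
  have hc'0 : ∀ α, 0 ≤ c' α := fun α => by
    simp only [c']; split_ifs
    exacts [norm_nonneg _, hc0 α]
  rw [phBohrSum, ENNReal.tsum_eq_iSup_sum]
  refine iSup_le fun S => ?_
  calc _ ≤ ∑ α ∈ S, ENNReal.ofReal (c' α) := by
        refine Finset.sum_le_sum fun α _ => iSup₂_le fun z hz => ENNReal.ofReal_le_ofReal ?_
        simp only [Real.rpow_one, ContinuousLinearMap.id_apply, c']
        split_ifs with hα
        · subst hα
          simp [hf.1, mpow]
        · exact hc1 α z hz
    _ ≤ ∑ α ∈ insert 0 (S.erase 0), ENNReal.ofReal (c' α) := by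
        refine Finset.sum_le_sum_of_subset fun α hα => ?_
        by_cases h : α = 0 <;> simp [h, hα]
    _ = ENNReal.ofReal (∑ α ∈ insert 0 (S.erase 0), c' α) :=
        (ENNReal.ofReal_sum_of_nonneg fun α _ => hc'0 α).symm
    _ ≤ _ := by
        refine ENNReal.ofReal_le_ofReal ?_
        rw [Finset.sum_insert (by simp), Real.rpow_one, Real.rpow_one]
        have h1 : ∑ α ∈ S.erase 0, c' α = ∑ α ∈ S.erase 0, c α :=
          Finset.sum_congr rfl fun α hα => if_neg (Finset.ne_of_mem_erase hα)
        have h2 := hc2 (S.erase 0) (by simp)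
        have h3 : c' 0 = ‖a 0‖ := if_pos rfl
        rw [h1, h3]
        linarith

theorem norm_mpow_smul {r : ℝ} (hr : 0 ≤ r) (w : Fin n → ℂ) (α : Fin n → ℕ) :
    ‖mpow (r • w) α‖ = (∏ j, r ^ α j) * ‖mpow w α‖ := by
  simp [norm_mpow, mul_pow, Finset.prod_mul_distrib, abs_of_nonneg hr]

variable [FiniteDimensional ℂ H]

/-- The second Bohr radius is at least of order `1 / n` on any complete Reinhardt domain. -/
theorem div_card_le_secondBohrPH {Ω : Set (Fin n → ℂ)} (hn : 1 ≤ n)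
    (hΩ : ∀ z ∈ Ω, ∀ w : Fin n → ℂ, (∀ j, ‖w j‖ ≤ ‖z j‖) → w ∈ Ω) (h0 : (0 : Fin n → ℂ) ∈ Ω)
    {δ lam : ℝ} (hδ0 : 0 ≤ δ) (hδ1 : δ ≤ 1 / 2) (hδ : 4 * Module.finrank ℂ H * δ ≤ lam - 1) :
    δ / n ≤ secondBohrPH Ω 1 lam (ContinuousLinearMap.id ℂ (H →L[ℂ] H)) := by
  have hn' : (1 : ℝ) ≤ n := by exact_mod_cast hn
  have hx0 : 0 ≤ δ / n := by positivity
  have hxδ : δ / n ≤ δ := div_le_self hδ0 hn'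
  refine le_secondBohrPH_one hΩ h0 ⟨hx0, by linarith⟩ fun f a b M hf hM => ?_
  have hM0 : 0 ≤ M := (norm_nonneg _).trans (hM 0 h0)
  set D : ℝ := (Module.finrank ℂ H : ℝ) with hD
  have hD0 : 0 ≤ D := by positivity
  refine ⟨fun α => 2 * D * M * ∏ j, (δ / n) ^ α j, ?_, ?_⟩
  · rintro α _ ⟨w, hw, rfl⟩
    have hP := sum_mpow_mul_norm_sq_le hΩ hf hM hw {α}
    rw [Finset.sum_singleton, ← hD] at hP
    have hDM : 0 ≤ D * M := by positivity
    have h1 : ‖mpow w α‖ * ‖a α‖ ≤ D * M :=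
      le_of_sq_le_sq (by nlinarith [sq_nonneg (‖mpow w α‖ * ‖b α‖)]) hDM
    have h2 : ‖mpow w α‖ * ‖b α‖ ≤ D * M :=
      le_of_sq_le_sq (by nlinarith [sq_nonneg (‖mpow w α‖ * ‖a α‖)]) hDM
    have hp : 0 ≤ ∏ j, (δ / n) ^ α j := by positivity
    change (‖a α‖ + ‖b α‖) * ‖mpow ((δ / n) • w) α‖ ≤ _
    rw [norm_mpow_smul hx0]
    calc _ = (‖mpow w α‖ * ‖a α‖ + ‖mpow w α‖ * ‖b α‖) * ∏ j, (δ / n) ^ α j := by ring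
      _ ≤ (D * M + D * M) * ∏ j, (δ / n) ^ α j := by gcongr
      _ = _ := by ring
  · intro S hS
    rw [← Finset.mul_sum]
    calc _ ≤ 2 * D * M * (2 * δ) := by
          gcongr; exact sum_prod_div_pow_le hn hδ0 hδ1 S hS
      _ = (4 * D * δ) * M := by ring
      _ ≤ _ := by gcongr

/-- A domain between `σ 𝔻ⁿ` and the closed polydisc has second Bohr radius at least of order
`σ / √n`. -/
theorem mul_div_sqrt_le_secondBohrPH {Ω : Set (Fin n → ℂ)} (hn : 1 ≤ n)
    (hΩ : ∀ z ∈ Ω, ∀ w : Fin n → ℂ, (∀ j, ‖w j‖ ≤ ‖z j‖) → w ∈ Ω) {σ : ℝ}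
    (hσ0 : 0 ≤ σ) (hσ1 : σ ≤ 1) (hσ : (fun _ => (σ : ℂ)) ∈ Ω)
    (hΩ1 : ∀ z ∈ Ω, ∀ j, ‖z j‖ ≤ 1)
    {δ lam : ℝ} (hδ0 : 0 ≤ δ) (hδ1 : δ ≤ 1 / 2) (hδ : 2 * Module.finrank ℂ H * δ ≤ lam - 1) :
    σ * (δ / Real.sqrt n) ≤ secondBohrPH Ω 1 lam (ContinuousLinearMap.id ℂ (H →L[ℂ] H)) := by
  have hn' : (1 : ℝ) ≤ n := by exact_mod_cast hn
  have hsn : 1 ≤ Real.sqrt n := Real.one_le_sqrt.2 hn'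
  have h0 : (0 : Fin n → ℂ) ∈ Ω := hΩ _ hσ _ fun j => by simp
  set x := δ / Real.sqrt n with hx
  have hx0 : 0 ≤ x := by positivity
  have hxδ : x ≤ δ := div_le_self hδ0 hsn
  have hr0 : 0 ≤ σ * x := by positivity
  refine le_secondBohrPH_one hΩ h0 ⟨hr0, by nlinarith⟩ fun f a b M hf hM => ?_
  have hM0 : 0 ≤ M := (norm_nonneg _).trans (hM 0 h0)
  set D : ℝ := (Module.finrank ℂ H : ℝ) with hD
  have hD0 : 0 ≤ D := by positivity
  refine ⟨fun α => (‖a α‖ + ‖b α‖) * ∏ j, (σ * x) ^ α j, ?_, ?_⟩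
  · rintro α _ ⟨w, hw, rfl⟩
    change (‖a α‖ + ‖b α‖) * ‖mpow ((σ * x) • w) α‖ ≤ _
    rw [norm_mpow_smul hr0, norm_mpow]
    have h1 : ∏ j, ‖w j‖ ^ α j ≤ 1 :=
      Finset.prod_le_one (fun _ _ => by positivity)
        fun j _ => pow_le_one₀ (norm_nonneg _) (hΩ1 w hw j)
    have hp : 0 ≤ ∏ j, (σ * x) ^ α j := by positivity
    exact mul_le_mul_of_nonneg_left (mul_le_of_le_one_right hp h1) (by positivity)
  · intro S hS
    have hP := sum_mpow_mul_norm_sq_le hΩ hf hM hσ S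
    rw [← hD] at hP
    have hσα : ∀ α, ‖mpow (fun _ : Fin n => (σ : ℂ)) α‖ = ∏ j, σ ^ α j := fun α => by
      simp [norm_mpow, abs_of_nonneg hσ0]
    have hx2 : x ^ 2 = δ ^ 2 / n := by
      rw [hx, div_pow, Real.sq_sqrt (by positivity)]
    have hgeom := sum_prod_div_pow_le hn (sq_nonneg δ) (by nlinarith) S hS
    have hCS := Finset.sum_mul_sq_le_sq_mul_sq S (fun α : Fin n → ℕ => ∏ j, x ^ α j)
      (fun α => (∏ j, σ ^ α j) * (‖a α‖ + ‖b α‖))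
    have e1 : ∑ α ∈ S, (∏ j, x ^ α j) ^ 2 ≤ 2 * δ ^ 2 := by
      refine le_trans (le_of_eq (Finset.sum_congr rfl fun α _ => ?_)) hgeom
      rw [← hx2, ← Finset.prod_pow]
      exact Finset.prod_congr rfl fun j _ => by ring
    have e2 : ∑ α ∈ S, ((∏ j, σ ^ α j) * (‖a α‖ + ‖b α‖)) ^ 2 ≤ 2 * (D * M) ^ 2 := by
      calc _ ≤ ∑ α ∈ S, 2 * (‖mpow (fun _ : Fin n => (σ : ℂ)) α‖ ^ 2 *
              (‖a α‖ ^ 2 + ‖b α‖ ^ 2)) := by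
            refine Finset.sum_le_sum fun α _ => ?_
            rw [hσα, mul_pow, mul_left_comm]
            gcongr
            exact add_sq_le
        _ ≤ _ := by rw [← Finset.mul_sum]; gcongr
    have e3 : ∑ α ∈ S, (‖a α‖ + ‖b α‖) * ∏ j, (σ * x) ^ α j =
        ∑ α ∈ S, (∏ j, x ^ α j) * ((∏ j, σ ^ α j) * (‖a α‖ + ‖b α‖)) := by
      refine Finset.sum_congr rfl fun α _ => ?_
      simp only [mul_pow, Finset.prod_mul_distrib]
      ring
    have e4 : ∑ α ∈ S, (‖a α‖ + ‖b α‖) * ∏ j, (σ * x) ^ α j ≤ 2 * D * δ * M := by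
      refine le_of_sq_le_sq ?_ (by positivity)
      rw [e3]
      calc _ ≤ _ := hCS
        _ ≤ (2 * δ ^ 2) * (2 * (D * M) ^ 2) := by gcongr
        _ = _ := by ring
    exact e4.trans (by gcongr)

end Radius

section Norms

variable {n : ℕ} {N : (Fin n → ℂ) → ℝ}

theorem eq_zero_or_le_idNorm_mul (N₁ N₂ : (Fin n → ℂ) → ℝ) (z : Fin n → ℂ) (hz : 0 ≤ N₁ z) :
    idNorm N₁ N₂ = 0 ∨ N₂ z ≤ idNorm N₁ N₂ * N₁ z := by
  rcases Set.eq_empty_or_nonempty {c : ℝ | 0 ≤ c ∧ ∀ z, N₂ z ≤ c * N₁ z} with h | h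
  · left; rw [idNorm, h, Real.sInf_empty]
  right
  rcases hz.eq_or_lt with h0 | h0
  · obtain ⟨c, hc⟩ := h
    have := hc.2 z
    rw [← h0] at this ⊢
    simpa using this
  · rw [← div_le_iff₀ h0]
    exact le_csInf h fun c hc => (div_le_iff₀ h0).2 (hc.2 z)

theorem idNorm_nonneg (N₁ N₂ : (Fin n → ℂ) → ℝ) : 0 ≤ idNorm N₁ N₂ :=
  Real.sInf_nonneg fun _ hc => hc.1

theorem IsNormalized1Unconditional.mono (hU : IsNormalized1Unconditional N) {z w : Fin n → ℂ}
    (h : ∀ j, ‖w j‖ ≤ ‖z j‖) : N w ≤ N z := by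
  have := hU.2 (fun j => w j / z j) z fun j => by
    rw [norm_div]; exact div_le_one_of_le₀ (h j) (norm_nonneg _)
  refine le_trans (le_of_eq (congrArg N (funext fun j => ?_))) this
  by_cases hz : z j = 0
  · have := h j
    rw [hz, norm_zero, norm_le_zero_iff] at this
    simp [hz, this]
  · exact (div_mul_cancel₀ _ hz).symm

theorem IsNormalized1Unconditional.norm_apply_le (hU : IsNormalized1Unconditional N)
    (hN : IsNorm N) (z : Fin n → ℂ) (k : Fin n) : ‖z k‖ ≤ N z := by
  have h1 := hN.2.2.1 (z k) (fun j => if j = k then 1 else 0)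
  rw [hU.1 k, mul_one] at h1
  rw [← h1]
  refine hU.mono fun j => ?_
  by_cases h : j = k <;> simp [h]

theorem lqNorm_single {q : ℝ≥0∞} (hq : 1 ≤ q) (k : Fin n) :
    lqNorm n q (fun j => if j = k then 1 else 0) = 1 := by
  have : Nonempty (Fin n) := ⟨k⟩
  unfold lqNorm
  split_ifs with h
  · refine le_antisymm (ciSup_le fun j => ?_) ?_
    · by_cases hj : j = k <;> simp [hj]
    · refine le_trans ?_ (le_ciSup (Set.finite_range _).bddAbove k)
      simp
  · have hq0 : q.toReal ≠ 0 := (ENNReal.toReal_pos (by positivity) h).ne'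
    rw [Finset.sum_eq_single k]
    · simp
    · intro j _ hj
      simp [hj, hq0]
    · simp

theorem lqNorm_one (hn : 1 ≤ n) (q : ℝ≥0∞) :
    lqNorm n q (fun _ => 1) = (n : ℝ) ^ (1 / q).toReal := by
  have : Nonempty (Fin n) := ⟨⟨0, hn⟩⟩
  unfold lqNorm
  split_ifs with h
  · simp [h]
  · simp

theorem lqNorm_nonneg (q : ℝ≥0∞) (z : Fin n → ℂ) : 0 ≤ lqNorm n q z := by
  unfold lqNorm
  split_ifs
  · exact Real.iSup_nonneg fun _ => norm_nonneg _
  · positivity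

end Norms

/-- Theorem 1.2, lower bound in the case `p = 1`. -/
theorem second_bohr_PH_asymp_lower_p_one
    (H : Type*) [NormedAddCommGroup H] [InnerProductSpace ℂ H] [CompleteSpace H]
    [Nontrivial H] [FiniteDimensional ℂ H] :
    ∃ E₁ : ℝ, 0 < E₁ ∧
      ∀ (n : ℕ), 1 ≤ n → ∀ N : (Fin n → ℂ) → ℝ,
        IsNorm N → IsNormalized1Unconditional N →
        ∀ lam : ℝ, 1 < lam → ∀ q : ℝ≥0∞, 1 ≤ q →
          E₁ * (1 / (idNorm N (lqNorm n q) * idNorm (lqNorm n q) N *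
                (n : ℝ) ^ (1 / q).toReal)) *
              max (1 / (Real.sqrt n * idNorm (lqNorm n 2) N))
                (1 / (Real.exp 1 * idNorm N (lqNorm n 1))) *
              ((lam - 1) / (2 * lam - 1)) ≤
            secondBohrPH (unitBall N) 1 lam (ContinuousLinearMap.id ℂ (H →L[ℂ] H)) := by
  set D : ℝ := (Module.finrank ℂ H : ℝ) with hD
  have hD1 : 1 ≤ D := by
    rw [hD]; exact_mod_cast Module.finrank_pos (R := ℂ) (M := H)
  refine ⟨1 / (8 * D), by positivity, fun n hn N hN hU lam hlam q hq => ?_⟩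
  have hΩ : ∀ z ∈ unitBall N, ∀ w : Fin n → ℂ, (∀ j, ‖w j‖ ≤ ‖z j‖) → w ∈ unitBall N :=
    fun z hz w hw => (hU.mono hw).trans_lt hz
  set K := (lam - 1) / (2 * lam - 1) with hK
  have hK0 : 0 ≤ K := div_nonneg (by linarith) (by linarith)
  have hK1 : K ≤ lam - 1 := div_le_self (by linarith) (by linarith)
  have hK2 : K ≤ 1 / 2 := by rw [hK, div_le_iff₀ (by linarith)]; linarith
  set τ := N fun _ => 1 with hτ
  have k : Fin n := ⟨0, hn⟩
  have hτ1 : 1 ≤ τ := by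
    simpa using hU.norm_apply_le hN (fun _ => 1) k
  have hn' : (1 : ℝ) ≤ n := by exact_mod_cast hn
  have hsn : 1 ≤ Real.sqrt n := Real.one_le_sqrt.2 hn'
  have hδ : 0 ≤ K / (4 * D) := by positivity
  have hδ1 : K / (4 * D) ≤ 1 / 2 := (div_le_self hK0 (by linarith)).trans hK2
  have hδ2 : D * (K / (4 * D)) = K / 4 := by field_simp
  have hσ : (fun _ => ((1 / (2 * τ) : ℝ) : ℂ)) ∈ unitBall N := by
    have h1 := hN.2.2.1 ((1 / (2 * τ) : ℝ) : ℂ) (fun _ => 1)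
    rw [← hτ, Complex.norm_real, Real.norm_of_nonneg (by positivity)] at h1
    have h2 : 1 / (2 * τ) * τ = 1 / 2 := by field_simp
    rw [h2] at h1
    change N _ < 1
    refine lt_of_le_of_lt (le_of_eq ?_) (by norm_num : (1 / 2 : ℝ) < 1)
    rw [← h1]
    congr 1
    funext j
    simp
  have h0 : (0 : Fin n → ℂ) ∈ unitBall N := hΩ _ hσ _ fun j => by simp
  have hL1 : 1 / (8 * D) * (1 / (τ * Real.sqrt n)) * K ≤
      secondBohrPH (unitBall N) 1 lam (ContinuousLinearMap.id ℂ (H →L[ℂ] H)) := by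
    have := mul_div_sqrt_le_secondBohrPH (H := H) (lam := lam) hn hΩ (by positivity)
      (by rw [div_le_one (by positivity)]; linarith) hσ
      (fun z hz j => (hU.norm_apply_le hN z j).trans (le_of_lt hz)) hδ hδ1
      (by rw [← hD, mul_assoc, hδ2]; linarith)
    refine le_trans (le_of_eq ?_) this
    field_simp
    ring
  have hL2 : 1 / (8 * D) * (1 / n) * K ≤
      secondBohrPH (unitBall N) 1 lam (ContinuousLinearMap.id ℂ (H →L[ℂ] H)) := by
    have := div_card_le_secondBohrPH (H := H) (lam := lam) hn hΩ h0 hδ hδ1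
      (by rw [← hD, mul_assoc, hδ2]; linarith)
    refine le_trans ?_ this
    have e : K / (4 * D) / n = 2 * (1 / (8 * D) * (1 / n) * K) := by field_simp; ring
    have : 0 ≤ 1 / (8 * D) * (1 / n) * K := by positivity
    linarith
  set s := idNorm N (lqNorm n q) with hs
  set t := idNorm (lqNorm n q) N with ht
  set u := idNorm (lqNorm n 2) N with hu
  set w := idNorm N (lqNorm n 1) with hw
  set ν := (n : ℝ) ^ (1 / q).toReal with hν
  have hs1 : s = 0 ∨ 1 ≤ s := by
    simpa [lqNorm_single hq k, hU.1 k] using eq_zero_or_le_idNorm_mul N (lqNorm n q)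
      (fun j => if j = k then 1 else 0) (hN.1 _)
  have ht1 : t = 0 ∨ τ ≤ t * ν := by
    simpa only [lqNorm_one hn q] using eq_zero_or_le_idNorm_mul (lqNorm n q) N
      (fun _ => 1) (lqNorm_nonneg q _)
  have hu1 : u = 0 ∨ 1 ≤ u := by
    simpa [lqNorm_single (q := 2) (by norm_num) k, hU.1 k] using
      eq_zero_or_le_idNorm_mul (lqNorm n 2) N
      (fun j => if j = k then 1 else 0) (lqNorm_nonneg 2 _)
  have hw1 : w = 0 ∨ n ≤ w * τ := by
    simpa [lqNorm_one hn 1] using eq_zero_or_le_idNorm_mul N (lqNorm n 1)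
      (fun _ => 1) (hN.1 _)
  have hst : s * t * ν = 0 ∨ τ ≤ s * t * ν := by
    rcases hs1 with h | h
    · simp [h]
    rcases ht1 with h' | h'
    · simp [h']
    right; nlinarith
  have hA : 1 / (s * t * ν) * (1 / (Real.sqrt n * u)) ≤ 1 / (τ * Real.sqrt n) := by
    rcases hst with h | h
    · rw [h]; simp; positivity
    rcases hu1 with h' | h'
    · rw [h']; simp; positivity
    rw [one_div_mul_one_div]
    refine one_div_le_one_div_of_le (by positivity) ?_
    exact mul_le_mul h (le_mul_of_one_le_right (by positivity) h') (by positivity) (by linarith)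
  have hB : 1 / (s * t * ν) * (1 / (Real.exp 1 * w)) ≤ 1 / n := by
    rcases hst with h | h
    · rw [h]; simp
    rcases hw1 with h' | h'
    · rw [h']; simp
    rw [one_div_mul_one_div]
    refine one_div_le_one_div_of_le (by positivity) ?_
    have hw0 : 0 ≤ w := idNorm_nonneg _ _
    have he : 1 ≤ Real.exp 1 := Real.one_le_exp (by norm_num)
    calc (n : ℝ) ≤ w * τ := h'
      _ = τ * w := mul_comm _ _
      _ ≤ s * t * ν * (Real.exp 1 * w) :=
        mul_le_mul h (le_mul_of_one_le_left hw0 he) hw0 (by linarith)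
  rw [mul_assoc (1 / (8 * D))]
  rcases max_choice (1 / (Real.sqrt n * u)) (1 / (Real.exp 1 * w)) with h | h
  · rw [h]
    exact le_trans (by gcongr) hL1
  · rw [h]
    exact le_trans (by gcongr) hL2

end BohrPaper
end
end
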